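/- arXiv:2211.08283 — 2 statements merged into one kernel-verified Lean document; each statement's English description precedes it below -/
import Mathlib

section
/- Let (G,c) be a red-blue colored twin-free graph with maximum degree Δ ≥ 3, with color classes R (the red vertices) and B (the blue vertices). Then sepRB(G,c) ≤ Δ·min{|R|,|B|}. -/
/-- The closed neighborhood `N[v]` of a vertex `v`. -/
def closedNbhd {V : Type*} (G : SimpleGraph V) (v : V) : Set V :=
  {u | G.Adj v u ∨ u = v}

/-- A graph is twin-free if distinct vertices have distinct closed neighborhoods. -/
def TwinFree {V : Type*} (G : SimpleGraph V) : Prop :=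
  ∀ u v : V, u ≠ v → closedNbhd G u ≠ closedNbhd G v

/-- `S` is a red-blue separating set of `(G, c)`, where `c v = true` means `v` is red
and `c v = false` means `v` is blue. -/
def IsRBSep {V : Type*} (G : SimpleGraph V) (c : V → Bool) (S : Set V) : Prop :=
  ∀ r b : V, c r = true → c b = false →
    closedNbhd G r ∩ S ≠ closedNbhd G b ∩ S

/-- `sepRB (G, c)`: the minimum size of a red-blue separating set of `(G, c)`. -/
noncomputable def sepRB {V : Type*} [Fintype V] (G : SimpleGraph V) (c : V → Bool) : ℕ :=
  sInf {m | ∃ S : Finset V, S.card = m ∧ IsRBSep G c ↑S}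

/-- `maxsepRB G`: the maximum over all red-blue colorings `c` of `sepRB (G, c)`. -/
noncomputable def maxsepRB {V : Type*} [Fintype V] (G : SimpleGraph V) : ℕ :=
  sSup (Set.range fun c : V → Bool => sepRB G c)

/-- `S` is a (non-colored) separating set of `G`. -/
def IsSep {V : Type*} (G : SimpleGraph V) (S : Set V) : Prop :=
  ∀ u v : V, u ≠ v → closedNbhd G u ∩ S ≠ closedNbhd G v ∩ S

/-- `sep G`: the minimum size of a separating set of `G`. -/
noncomputable def sepNum {V : Type*} [Fintype V] (G : SimpleGraph V) : ℕ :=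
  sInf {m | ∃ S : Finset V, S.card = m ∧ IsSep G ↑S}

/-- Each vertex can be separated from all the others by at most `Δ` vertices. -/
lemma exists_local_sep {V : Type*} [Fintype V] (G : SimpleGraph V) [DecidableRel G.Adj]
    (htwin : TwinFree G) (hdeg : 3 ≤ G.maxDegree) (r : V) :
    ∃ S : Finset V, S.card ≤ G.maxDegree ∧
      ∀ u, u ≠ r → ∃ s ∈ S, ¬ (s ∈ closedNbhd G r ↔ s ∈ closedNbhd G u) := by
  classical
  have key : ∀ u, u ≠ r → (∀ s ∈ closedNbhd G r, s ∈ closedNbhd G u) →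
      ∃ s, s ∈ closedNbhd G u ∧ s ∉ closedNbhd G r := by
    intro u hu h
    by_contra! hc
    exact htwin u r hu (Set.ext fun s => ⟨hc s, h s⟩)
  rcases lt_or_eq_of_le (G.degree_le_maxDegree r) with hlt | heq
  · have : ∀ z, ∃ y, z ≠ r →
        ((∀ s ∈ closedNbhd G r, s ∈ closedNbhd G z) → y ∈ closedNbhd G z ∧ y ∉ closedNbhd G r) ∧
        ((¬ ∀ s ∈ closedNbhd G r, s ∈ closedNbhd G z) → y = z) := by
      intro z
      by_cases hz : z ≠ r
      · by_cases h : ∀ s ∈ closedNbhd G r, s ∈ closedNbhd G z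
        · obtain ⟨y, hy⟩ := key z hz h
          exact ⟨y, fun _ => ⟨fun _ => hy, fun h' => absurd h h'⟩⟩
        · exact ⟨z, fun _ => ⟨fun h' => absurd h' h, fun _ => rfl⟩⟩
      · exact ⟨z, fun h => absurd h hz⟩
    choose f hf using this
    refine ⟨insert r ((G.neighborFinset r).image f), ?_, ?_⟩
    · have h1 := Finset.card_insert_le r ((G.neighborFinset r).image f)
      have h2 : ((G.neighborFinset r).image f).card ≤ (G.neighborFinset r).card :=
        Finset.card_image_le
      rw [G.card_neighborFinset_eq_degree] at h2
      omega
    · intro u hu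
      by_cases hadj : G.Adj r u
      · by_cases h : ∀ s ∈ closedNbhd G r, s ∈ closedNbhd G u
        · have := ((hf u hu).1 h)
          refine ⟨f u, ?_, by tauto⟩
          exact Finset.mem_insert_of_mem (Finset.mem_image_of_mem f (by simpa using hadj))
        · have h0 := h
          push Not at h
          obtain ⟨s, hs, hsu⟩ := h
          have hsr : s ≠ r := by
            rintro rfl
            exact hsu (Or.inl hadj.symm)
          have hrs : G.Adj r s := hs.resolve_right hsr
          have hns : ¬ ∀ t ∈ closedNbhd G r, t ∈ closedNbhd G s := by
            intro h
            rcases h u (Or.inl hadj) with h | h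
            · exact hsu (Or.inl h.symm)
            · exact hsu (Or.inr h.symm)
          refine ⟨s, ?_, by tauto⟩
          have := (hf s hsr).2 hns
          rw [Finset.mem_insert, Finset.mem_image]
          exact Or.inr ⟨s, by simpa using hrs, this⟩
      · refine ⟨r, Finset.mem_insert_self _ _, fun h => ?_⟩
        rcases h.1 (Or.inr rfl) with h | h
        · exact hadj h.symm
        · exact hu h.symm
  · by_cases hw : ∃ w, w ≠ r ∧ G.neighborFinset w = G.neighborFinset r
    · obtain ⟨w, hwr, hN⟩ := hw
      have hN' : ∀ s, G.Adj w s ↔ G.Adj r s := by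
        intro s
        rw [← G.mem_neighborFinset, hN, G.mem_neighborFinset]
      refine ⟨{r, w}, Finset.card_le_two.trans (by omega), ?_⟩
      intro u hu
      by_cases hadj : G.Adj r u
      · refine ⟨w, by simp, fun h => ?_⟩
        rcases h.2 (Or.inl ((hN' u).2 hadj).symm) with h | h
        · exact G.loopless.irrefl w ((hN' w).2 h)
        · exact hwr h
      · refine ⟨r, by simp, fun h => ?_⟩
        rcases h.1 (Or.inr rfl) with h | h
        · exact hadj h.symm
        · exact hu h.symm
    · refine ⟨G.neighborFinset r, by rw [G.card_neighborFinset_eq_degree, heq], ?_⟩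
      intro u hu
      by_contra! hc
      have hsub : ∀ s, G.Adj r s → s ∈ closedNbhd G u := fun s hs =>
        (hc s (by simpa using hs)).1 (Or.inl hs)
      have hud := G.degree_le_maxDegree u
      by_cases hadj : G.Adj r u
      · have hss : insert r (G.neighborFinset r) ⊆ insert u (G.neighborFinset u) := by
          intro s hs
          rw [Finset.mem_insert, G.mem_neighborFinset] at hs ⊢
          rcases hs with rfl | hs
          · exact Or.inr hadj.symm
          · exact (hsub s hs).symm
        have he := Finset.eq_of_subset_of_card_le hss (by
          rw [Finset.card_insert_of_notMem (by simp), Finset.card_insert_of_notMem (by simp),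
            G.card_neighborFinset_eq_degree, G.card_neighborFinset_eq_degree]
          omega)
        refine htwin r u hu.symm (Set.ext fun s => ?_)
        have := Finset.ext_iff.1 he s
        simp only [Finset.mem_insert, G.mem_neighborFinset] at this
        simp only [closedNbhd, Set.mem_setOf_eq]
        tauto
      · refine hw ⟨u, hu, ?_⟩
        refine (Finset.eq_of_subset_of_card_le ?_ ?_).symm
        · intro s hs
          rw [G.mem_neighborFinset] at hs ⊢
          rcases hsub s hs with h | rfl
          · exact h
          · exact absurd hs hadj
        · rw [G.card_neighborFinset_eq_degree, G.card_neighborFinset_eq_degree]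
          omega

theorem stmt1 {V : Type*} [Fintype V] (G : SimpleGraph V) [DecidableRel G.Adj]
    (c : V → Bool) (htwin : TwinFree G) (hdeg : 3 ≤ G.maxDegree) :
    sepRB G c ≤ G.maxDegree * min ((Finset.univ.filter fun v => c v = true).card)
      ((Finset.univ.filter fun v => c v = false).card) := by
  classical
  choose S hS hsep using exists_local_sep G htwin hdeg
  have main : ∀ a : Bool, sepRB G c ≤
      G.maxDegree * (Finset.univ.filter fun v => c v = a).card := by
    intro a
    have hcard : ((Finset.univ.filter fun v => c v = a).biUnion S).card ≤
        (Finset.univ.filter fun v => c v = a).card * G.maxDegree :=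
      Finset.card_biUnion_le_card_mul _ _ _ fun v _ => hS v
    rw [mul_comm]
    refine le_trans (Nat.sInf_le ⟨_, rfl, ?_⟩) hcard
    intro r b hr hb heq
    have hrb : r ≠ b := by
      rintro rfl
      simp [hr] at hb
    have hiff : ∀ s ∈ (Finset.univ.filter fun v => c v = a).biUnion S,
        (s ∈ closedNbhd G r ↔ s ∈ closedNbhd G b) := by
      intro s hs
      have := Set.ext_iff.1 heq s
      simp only [Set.mem_inter_iff, Finset.mem_coe, hs, and_true] at this
      exact this
    cases a with
    | true =>
      obtain ⟨s, hs, hn⟩ := hsep r b hrb.symm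
      exact hn (hiff s (Finset.mem_biUnion.2 ⟨r, by simpa using hr, hs⟩))
    | false =>
      obtain ⟨s, hs, hn⟩ := hsep b r hrb
      exact hn (hiff s (Finset.mem_biUnion.2 ⟨b, by simpa using hb, hs⟩)).symm
  rcases min_choice ((Finset.univ.filter fun v => c v = true).card)
      ((Finset.univ.filter fun v => c v = false).card) with h | h <;> rw [h]
  · exact main true
  · exact main false
end

section
/- For any tree T of order n ≥ 5, maxsepRB(T) ≤ 2n/3. -/
section RBProof

variable {V : Type*}

lemma mem_cn (T : SimpleGraph V) (u v : V) : u ∈ closedNbhd T v ↔ T.Adj v u ∨ u = v := Iff.rfl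

/-- Separation part of the parity construction. -/
lemma rb_sep (T : SimpleGraph V) (c p : V → Bool)
    (hp : ∀ u v, T.Adj u v → p u ≠ p v)
    (hC4 : ∀ u v y z, u ≠ v → T.Adj u y → T.Adj u z → T.Adj v y → T.Adj v z → y = z)
    (Leaf : V → Prop) (s : V → V)
    (hs : ∀ l, Leaf l → ∀ y, T.Adj l y ↔ y = s l)
    (hnl : ∀ v, ¬ Leaf v → ∀ x, ∃ y, T.Adj v y ∧ y ≠ x)
    (hsl : ∀ l, Leaf l → ¬ Leaf (s l))
    (w : V → V) (hw : ∀ v, ¬ Leaf v → T.Adj v (w v) ∧ ¬ Leaf (w v))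
    (M : V → Prop)
    (hM : ∀ l l', Leaf l → Leaf l' → s l = s l' → ¬ M l → ¬ M l' → c l = c l')
    (a : Bool) (S : Set V)
    (F1 : ∀ v, ¬ Leaf v → p v = a → v ∈ S)
    (F2 : ∀ l, Leaf l → s l ∈ S ∨ (∀ l', Leaf l' → s l' = s l → l' ∈ S))
    (F4 : ∀ l, Leaf l → M l → l ∈ S)
    (F5 : ∀ l, Leaf l → p (s l) = a → w (s l) ∈ S ∨
      ((∃ m, Leaf m ∧ s m = s l ∧ M m) ∧ ∀ m, Leaf m → s m = s l → M m → c m = c (s l)))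
    (F6 : ∀ l, Leaf l → p (s l) ≠ a →
      (∀ y z, T.Adj (s l) y → T.Adj (s l) z → ¬ Leaf y → ¬ Leaf z → y = z) →
      ∃ m, Leaf m ∧ s m = s l ∧ m ∈ S) :
    ∀ u v, c u ≠ c v → closedNbhd T u ∩ S ≠ closedNbhd T v ∩ S := by
  have hls : ∀ l, Leaf l → T.Adj l (s l) := fun l hl => (hs l hl _).2 rfl
  have hadj : ∀ l, Leaf l → ∀ v, T.Adj v l → v = s l := fun l hl v h => (hs l hl v).1 h.symm
  -- nonleaf vertex of class ≠ a with at most one nonleaf neighbour sees a leaf in S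
  have hG : ∀ v, ¬ Leaf v → p v ≠ a →
      (∀ y z, T.Adj v y → T.Adj v z → ¬ Leaf y → ¬ Leaf z → y = z) →
      ∃ m, Leaf m ∧ s m = v ∧ m ∈ S := by
    intro v hv hpv h
    obtain ⟨y, hy, hyw⟩ := hnl v hv (w v)
    have hyl : Leaf y := by
      by_contra hyl
      exact hyw (h _ _ hy (hw v hv).1 hyl (hw v hv).2)
    have e := hadj y hyl v hy
    subst e
    exact F6 y hyl hpv h
  -- leaf versus nonleaf
  have hLN : ∀ l v, Leaf l → ¬ Leaf v → c l ≠ c v →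
      (∀ z ∈ S, (T.Adj l z ∨ z = l) ↔ (T.Adj v z ∨ z = v)) → False := by
    intro l v hl hv hc h
    have hin : ∀ z ∈ S, (T.Adj v z ∨ z = v) → z = s l ∨ z = l := by
      intro z hz h1
      have := (h z hz).2 h1
      rwa [hs l hl] at this
    have hx := hsl l hl
    have hwx := hw _ hx
    have hwne : w (s l) ≠ s l := hwx.1.ne'
    have hwnl : w (s l) ≠ l := fun e => hwx.2 (by rw [e]; exact hl)
    have hvl : v ≠ l := fun e => hv (e ▸ hl)
    -- the case v = s l
    have hcase : v ≠ s l := by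
      intro hvx
      have hwS : w (s l) ∉ S := by
        intro hwS
        rcases hin _ hwS (Or.inl (hvx ▸ hwx.1)) with h1 | h1
        · exact hwne h1
        · exact hwnl h1
      by_cases hpa : p (s l) = a
      · rcases F5 l hl hpa with h1 | ⟨⟨m, hm, hms, hMm⟩, h2⟩
        · exact hwS h1
        · have hmS := F4 m hm hMm
          have hmv : T.Adj v m := by rw [hvx, ← hms]; exact (hls m hm).symm
          rcases hin m hmS (Or.inl hmv) with h3 | h3
          · exact hx (h3 ▸ hm)
          · subst h3
            exact hc (by rw [h2 m hm rfl hMm, hvx])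
      · apply hwS
        apply F1 _ hwx.2
        have := hp _ _ hwx.1
        revert this hpa
        cases p (s l) <;> cases p (w (s l)) <;> cases a <;> simp
    rcases F2 l hl with hxS | hL
    · have hvx : T.Adj v (s l) := by
        rcases (h _ hxS).1 (Or.inl (hls l hl)) with h1 | h1
        · exact h1
        · exact absurd h1.symm hcase
      have hvS : v ∉ S := by
        intro hvS
        rcases hin v hvS (Or.inr rfl) with h1 | h1
        · exact hcase h1
        · exact hvl h1
      have hpv : p v ≠ a := fun h1 => hvS (F1 v hv h1)
      obtain ⟨y, hy, hyx⟩ := hnl v hv (s l)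
      by_cases hyl : Leaf y
      · have hvy := hadj y hyl v hy
        rcases F2 y hyl with h1 | h1
        · exact hvS (hvy ▸ h1)
        · rcases hin y (h1 y hyl rfl) (Or.inl hy) with h2 | h2
          · exact hyx h2
          · subst h2; exact hcase hvy
      · have hyS : y ∈ S := by
          apply F1 _ hyl
          have := hp _ _ hy
          revert this hpv
          cases p v <;> cases p y <;> cases a <;> simp
        rcases hin y hyS (Or.inl hy) with h2 | h2
        · exact hyx h2
        · exact hyl (h2 ▸ hl)
    · rcases (h l (hL l hl rfl)).1 (Or.inr rfl) with h1 | h1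
      · exact hcase (hadj l hl v h1)
      · exact hvl h1.symm
  -- nonleaf versus nonleaf, first of class a
  have hNN : ∀ u v, ¬ Leaf u → ¬ Leaf v → u ≠ v → p u = a →
      (∀ z ∈ S, (T.Adj u z ∨ z = u) ↔ (T.Adj v z ∨ z = v)) → False := by
    intro u v hu hv huv hpu h
    have huS := F1 u hu hpu
    have hvu : T.Adj v u := by
      rcases (h u huS).1 (Or.inr rfl) with h1 | h1
      · exact h1
      · exact absurd h1 huv
    have hpv : p v ≠ a := fun e => hp _ _ hvu (e.trans hpu.symm)
    have key : ∀ y, T.Adj v y → ¬ Leaf y → y = u := by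
      intro y hy hyl
      have hpy : p y = a := by
        have := hp _ _ hy
        revert this hpv
        cases p v <;> cases p y <;> cases a <;> simp
      rcases (h y (F1 y hyl hpy)).2 (Or.inl hy) with h1 | h1
      · exact absurd (hpu.trans hpy.symm) (hp _ _ h1)
      · exact h1
    obtain ⟨m, hm, hmv, hmS⟩ := hG v hv hpv
      (fun y z hy hz hyl hzl => (key y hy hyl).trans (key z hz hzl).symm)
    rcases (h m hmS).2 (Or.inl (hmv ▸ (hls m hm).symm)) with h1 | h1
    · exact huv ((hadj m hm u h1).trans hmv)
    · exact hu (h1 ▸ hm)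
  intro u v hc heq
  have h : ∀ z ∈ S, (T.Adj u z ∨ z = u) ↔ (T.Adj v z ∨ z = v) := by
    intro z hz
    have := Set.ext_iff.1 heq z
    simpa [closedNbhd, hz] using this
  have huv : u ≠ v := fun e => hc (by rw [e])
  by_cases hu : Leaf u <;> by_cases hv : Leaf v
  · by_cases hxx : s u = s v
    · by_cases hMu : M u
      · rcases (h u (F4 u hu hMu)).1 (Or.inr rfl) with h1 | h1
        · have := hadj u hu v h1
          exact hsl u hu (this ▸ hv)
        · exact huv h1
      · by_cases hMv : M v
        · rcases (h v (F4 v hv hMv)).2 (Or.inr rfl) with h1 | h1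
          · have := hadj v hv u h1
            exact hsl v hv (this ▸ hu)
          · exact huv h1.symm
        · exact hc (hM u v hu hv hxx hMu hMv)
    · rcases F2 u hu with h1 | h1
      · rcases (h _ h1).1 (Or.inl (hls u hu)) with h2 | h2
        · exact hxx ((hs v hv _).1 h2)
        · exact hsl u hu (h2 ▸ hv)
      · rcases (h u (h1 u hu rfl)).1 (Or.inr rfl) with h2 | h2
        · have := hadj u hu v h2
          exact hsl u hu (this ▸ hv)
        · exact huv h2
  · exact hLN u v hu hv hc h
  · exact hLN v u hv hu hc.symm (fun z hz => (h z hz).symm)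
  · by_cases hpu : p u = a
    · exact hNN u v hu hv huv hpu h
    by_cases hpv : p v = a
    · exact hNN v u hv hu huv.symm hpv (fun z hz => (h z hz).symm)
    have hnadj : ¬ T.Adj v u := by
      intro h1
      have := hp _ _ h1
      revert this hpu hpv
      cases p v <;> cases p u <;> cases a <;> simp
    have hav : ∀ y, T.Adj u y → ¬ Leaf y → T.Adj v y := by
      intro y hy hyl
      have hpy : p y = a := by
        have := hp _ _ hy
        revert this hpu
        cases p u <;> cases p y <;> cases a <;> simp
      rcases (h y (F1 y hyl hpy)).1 (Or.inl hy) with h1 | h1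
      · exact h1
      · exact absurd (h1 ▸ hpy) hpv
    obtain ⟨m, hm, hmv, hmS⟩ := hG u hu hpu
      (fun y z hy hz hyl hzl => hC4 u v y z huv hy hz (hav y hy hyl) (hav z hz hzl))
    rcases (h m hmS).1 (Or.inl (hmv ▸ (hls m hm).symm)) with h1 | h1
    · exact huv (((hadj m hm v h1).trans hmv).symm)
    · exact hv (h1 ▸ hm)

/-- The parity construction: a separating set of size at most `(n + s) / 2`. -/
lemma rb_half [Fintype V] [DecidableEq V] (T : SimpleGraph V) (c p : V → Bool)
    (hp : ∀ u v, T.Adj u v → p u ≠ p v)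
    (hC4 : ∀ u v y z, u ≠ v → T.Adj u y → T.Adj u z → T.Adj v y → T.Adj v z → y = z)
    (Leaf : V → Prop) [DecidablePred Leaf] (s : V → V)
    (hs : ∀ l, Leaf l → ∀ y, T.Adj l y ↔ y = s l)
    (hnl : ∀ v, ¬ Leaf v → ∀ x, ∃ y, T.Adj v y ∧ y ≠ x)
    (hsl : ∀ l, Leaf l → ¬ Leaf (s l))
    (w : V → V) (hw : ∀ v, ¬ Leaf v → T.Adj v (w v) ∧ ¬ Leaf (w v)) :
    ∃ S : Finset V, 2 * S.card ≤ Fintype.card V + ((Finset.univ.filter Leaf).image s).card ∧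
      ∀ u v, c u ≠ c v → closedNbhd T u ∩ (S : Set V) ≠ closedNbhd T v ∩ (S : Set V) := by
  classical
  set Lf : Finset V := Finset.univ.filter Leaf with hLf
  set Sup : Finset V := Lf.image s with hSup
  let L : V → Finset V := fun x => Lf.filter (fun l => s l = x)
  let R : V → Finset V := fun x => (L x).filter (fun l => c l = c x)
  let B : V → Finset V := fun x => (L x).filter (fun l => ¬ c l = c x)
  let M : V → Finset V := fun x => if (R x).card ≤ (B x).card then R x else B x
  have hmL : ∀ l x, l ∈ L x ↔ Leaf l ∧ s l = x := by intro l x; simp [L, hLf]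
  have hmS : ∀ x, x ∈ Sup ↔ ∃ l, Leaf l ∧ s l = x := by intro x; simp [hSup, hLf]
  have hRB : ∀ x, (R x).card + (B x).card = (L x).card := fun x =>
    Finset.card_filter_add_card_filter_not (s := L x) (fun l => c l = c x)
  have hML : ∀ x, M x ⊆ L x := by
    intro x
    simp only [M]
    split_ifs
    · exact Finset.filter_subset _ _
    · exact Finset.filter_subset _ _
  have hM2 : ∀ x, 2 * (M x).card ≤ (L x).card := by
    intro x
    have := hRB x
    simp only [M]
    split_ifs <;> omega
  have hMeq : ∀ x, ¬ 2 * (M x).card < (L x).card → ∀ m ∈ M x, c m = c x := by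
    intro x h m hm
    have := hRB x
    by_cases h1 : (R x).card ≤ (B x).card
    · simp only [M, if_pos h1] at hm
      exact (Finset.mem_filter.1 hm).2
    · simp only [M, if_neg h1] at h
      omega
  have hMc : ∀ x, ∀ l ∈ L x, ∀ l' ∈ L x, l ∉ M x → l' ∉ M x → c l = c l' := by
    intro x l hl l' hl' h h'
    by_cases h1 : (R x).card ≤ (B x).card
    · simp only [M, if_pos h1, R, Finset.mem_filter, not_and] at h h'
      have a1 := h hl
      have a2 := h' hl'
      revert a1 a2
      cases c l <;> cases c l' <;> cases c x <;> simp
    · simp only [M, if_neg h1, B, Finset.mem_filter, not_and, not_not] at h h'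
      rw [h hl, h' hl']
  have he : ∃ e : V → V, ∀ x ∈ Sup, e x ∈ L x := by
    have : ∀ x, ∃ l, x ∈ Sup → l ∈ L x := by
      intro x
      by_cases hx : x ∈ Sup
      · obtain ⟨l, hl⟩ := (hmS x).1 hx
        exact ⟨l, fun _ => (hmL l x).2 hl⟩
      · exact ⟨x, fun h => absurd h hx⟩
    choose e he using this
    exact ⟨e, he⟩
  obtain ⟨e, he⟩ := he
  let d1 : V → Prop := fun x =>
    ∀ y z, T.Adj x y → T.Adj x z → ¬ Leaf y → ¬ Leaf z → y = z
  let C : V → Prop := fun x => (L x).card = 1 ∧ d1 x ∧ w x ∉ Sup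
  let FA : V → Finset V := fun x =>
    ({x} ∪ M x) ∪ (if 2 * (M x).card < (L x).card ∧ w x ∉ Sup then {w x} else ∅)
  let FB : V → Finset V := fun x =>
    ((if C x then ∅ else {x}) ∪ M x) ∪ (if d1 x ∧ M x = ∅ then {e x} else ∅)
  let F : Bool → V → Finset V := fun a x => if p x = a then FA x else FB x
  let I : Finset V := Finset.univ.filter (fun v => ¬ Leaf v ∧ v ∉ Sup)
  let S : Bool → Finset V := fun a => I.filter (fun v => p v = a) ∪ Sup.biUnion (F a)
  have hFAB : ∀ x ∈ Sup, (FA x).card + (FB x).card ≤ 2 + (L x).card := by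
    intro x hx
    have hLpos : 0 < (L x).card := Finset.card_pos.2 ⟨_, he x hx⟩
    have a1 : (FA x).card ≤ 1 + (M x).card +
        (if 2 * (M x).card < (L x).card ∧ w x ∉ Sup then 1 else 0) := by
      refine (Finset.card_union_le _ _).trans (add_le_add ((Finset.card_union_le _ _).trans ?_) ?_)
      · simp
      · split_ifs <;> simp
    have a2 : (FB x).card ≤ (if C x then 0 else 1) + (M x).card +
        (if d1 x ∧ M x = ∅ then 1 else 0) := by
      refine (Finset.card_union_le _ _).trans (add_le_add ((Finset.card_union_le _ _).trans ?_) ?_)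
      · split_ifs <;> simp
      · split_ifs <;> simp
    have h2 := hM2 x
    by_cases hM0 : M x = ∅
    · have hc0 : (M x).card = 0 := by rw [hM0]; rfl
      by_cases hC : C x
      · have := hC.1
        rw [if_pos hC] at a2
        split_ifs at a1 a2 <;> omega
      · rw [if_neg hC] at a2
        by_cases hL1 : (L x).card = 1
        · by_cases hd : d1 x
          · have hws : w x ∈ Sup := by
              by_contra hws
              exact hC ⟨hL1, hd, hws⟩
            rw [if_neg (fun h => h.2 hws)] at a1
            split_ifs at a2 <;> omega
          · rw [if_neg (fun h => hd h.1)] at a2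
            split_ifs at a1 <;> omega
        · split_ifs at a1 a2 <;> omega
    · have hc0 : 0 < (M x).card := Finset.card_pos.2 (Finset.nonempty_iff_ne_empty.2 hM0)
      rw [if_neg (show ¬ (d1 x ∧ M x = ∅) from fun h => hM0 h.2)] at a2
      split_ifs at a1 a2 <;> omega
  have hn : I.card + Sup.card + Lf.card = Fintype.card V := by
    have h1 := Finset.card_filter_add_card_filter_not (s := (Finset.univ : Finset V)) Leaf
    have h2 := Finset.card_filter_add_card_filter_not
      (s := Finset.univ.filter (fun v => ¬ Leaf v)) (fun v => v ∈ Sup)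
    have h3 : (Finset.univ.filter (fun v => ¬ Leaf v)).filter (fun v => v ∈ Sup) = Sup := by
      ext v
      simp only [Finset.mem_filter, Finset.mem_univ, true_and, and_iff_right_iff_imp]
      intro hv
      obtain ⟨l, hl, rfl⟩ := (hmS v).1 hv
      exact hsl l hl
    have h4 : (Finset.univ.filter (fun v => ¬ Leaf v)).filter (fun v => ¬ v ∈ Sup) = I := by
      rw [Finset.filter_filter]
    rw [h3, h4] at h2
    rw [Finset.card_univ] at h1
    simp only [hLf]
    omega
  have hLs : Lf.card = ∑ x ∈ Sup, (L x).card :=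
    Finset.card_eq_sum_card_fiberwise (fun l hl => Finset.mem_image_of_mem s hl)
  have hcard : (S true).card + (S false).card ≤ Fintype.card V + Sup.card := by
    have b : ∀ a, (S a).card ≤ (I.filter (fun v => p v = a)).card + ∑ x ∈ Sup, (F a x).card :=
      fun a => (Finset.card_union_le _ _).trans (Nat.add_le_add_left Finset.card_biUnion_le _)
    have hI : (I.filter (fun v => p v = true)).card + (I.filter (fun v => p v = false)).card
        = I.card := by
      rw [← Finset.card_filter_add_card_filter_not (s := I) (fun v => p v = true)]
      simp
    have hsum : ∑ x ∈ Sup, (F true x).card + ∑ x ∈ Sup, (F false x).card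
        ≤ ∑ x ∈ Sup, (2 + (L x).card) := by
      rw [← Finset.sum_add_distrib]
      apply Finset.sum_le_sum
      intro x hx
      have := hFAB x hx
      simp only [F]
      cases p x <;> simp <;> omega
    rw [Finset.sum_add_distrib, ← hLs, Finset.sum_const, smul_eq_mul] at hsum
    have := b true
    have := b false
    omega
  have hex : ∃ a, 2 * (S a).card ≤ Fintype.card V + Sup.card := by
    by_cases h : (S true).card ≤ (S false).card
    · exact ⟨true, by omega⟩
    · exact ⟨false, by omega⟩
  obtain ⟨a, ha⟩ := hex
  refine ⟨S a, ha, ?_⟩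
  have hsS : ∀ l, Leaf l → s l ∈ Sup := fun l hl => (hmS _).2 ⟨l, hl, rfl⟩
  have hF : ∀ x ∈ Sup, ∀ v ∈ F a x, v ∈ S a := fun x hx v hv =>
    Finset.mem_union_right _ (Finset.mem_biUnion.2 ⟨x, hx, hv⟩)
  have hFx : ∀ x ∈ Sup, p x = a → x ∈ S a := by
    intro x hx h
    apply hF x hx
    simp [F, h, FA]
  have hFM : ∀ x ∈ Sup, ∀ m ∈ M x, m ∈ S a := by
    intro x hx m hm
    apply hF x hx
    by_cases h : p x = a
    · simp [F, h, FA, hm]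
    · simp [F, h, FB, hm]
  have hFe : ∀ x ∈ Sup, p x ≠ a → d1 x → M x = ∅ → e x ∈ S a := by
    intro x hx h hd hm
    apply hF x hx
    simp [F, h, FB, hm, hd]
  have hnC : ∀ x ∈ Sup, ¬ C x → x ∈ S a := by
    intro x hx hC
    by_cases h : p x = a
    · exact hFx x hx h
    · apply hF x hx
      simp [F, h, FB, hC]
  have hF1 : ∀ v, ¬ Leaf v → p v = a → v ∈ S a := by
    intro v hv hpv
    by_cases hvS : v ∈ Sup
    · exact hFx v hvS hpv
    · apply Finset.mem_union_left
      simp [I, hv, hvS, hpv]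
  have hCM : ∀ x, C x → M x = ∅ := by
    intro x hC
    have := hC.1
    have := hM2 x
    exact Finset.card_eq_zero.1 (by omega)
  refine rb_sep T c p hp hC4 Leaf s hs hnl hsl w hw (fun l => l ∈ M (s l)) ?_ a _ hF1 ?_ ?_ ?_ ?_
  · intro l l' hl hl' hss h h'
    rw [← hss] at h'
    exact hMc (s l) l ((hmL _ _).2 ⟨hl, rfl⟩) l' ((hmL _ _).2 ⟨hl', hss.symm⟩) h h'
  · intro l hl
    by_cases hC : C (s l)
    · by_cases h : p (s l) = a
      · exact Or.inl (hFx _ (hsS l hl) h)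
      · right
        intro l' hl' hss
        have h1 := hFe _ (hsS l hl) h hC.2.1 (hCM _ hC)
        have h2 := he _ (hsS l hl)
        have h3 : l' = e (s l) :=
          Finset.card_le_one.1 hC.1.le l' ((hmL _ _).2 ⟨hl', hss⟩) _ h2
        rw [h3]
        exact h1
    · exact Or.inl (hnC _ (hsS l hl) hC)
  · intro l hl hm
    exact hFM _ (hsS l hl) l hm
  · intro l hl hpa
    by_cases h : 2 * (M (s l)).card < (L (s l)).card
    · left
      by_cases hws : w (s l) ∈ Sup
      · apply hnC _ hws
        intro hC
        have hx := hsl l hl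
        have h1 := hw _ hx
        have h2 := hw _ h1.2
        have h3 := hC.2.1 _ _ h1.1.symm h2.1 hx h2.2
        exact hC.2.2 (h3 ▸ hsS l hl)
      · apply hF _ (hsS l hl)
        simp [F, hpa, FA, h, hws]
    · right
      have hpos : 0 < (L (s l)).card := Finset.card_pos.2 ⟨l, (hmL _ _).2 ⟨hl, rfl⟩⟩
      have hpos2 : 0 < (M (s l)).card := by omega
      obtain ⟨m, hm⟩ := Finset.card_pos.1 hpos2
      have hmm := (hmL _ _).1 (hML _ hm)
      refine ⟨⟨m, hmm.1, hmm.2, ?_⟩, ?_⟩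
      · simpa only [hmm.2] using hm
      · intro m' hm' hss hmM
        have hmM' : m' ∈ M (s l) := by simpa only [hss] using hmM
        exact hMeq _ h m' hmM'
  · intro l hl hpa hd
    by_cases hM0 : M (s l) = ∅
    · have h2 := (hmL _ _).1 (he _ (hsS l hl))
      exact ⟨e (s l), h2.1, h2.2, hFe _ (hsS l hl) hpa hd hM0⟩
    · obtain ⟨m, hm⟩ := Finset.nonempty_iff_ne_empty.2 hM0
      have hmm := (hmL _ _).1 (hML _ hm)
      exact ⟨m, hmm.1, hmm.2, hFM _ (hsS l hl) m hm⟩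

lemma conn_closed (T : SimpleGraph V) (hT : T.Connected) (K : Set V) (x : V) (hx : x ∈ K)
    (h : ∀ u ∈ K, ∀ v, T.Adj u v → v ∈ K) (v : V) : v ∈ K := by
  obtain ⟨q⟩ := hT.preconnected x v
  induction q with
  | nil => exact hx
  | cons hadj _ ih => exact ih (h _ hx _ hadj)

/-- Dropping one leaf per support vertex. -/
lemma rb_drop [Fintype V] [DecidableEq V] (T : SimpleGraph V) (p : V → Bool)
    (hconn : T.Connected) (hcard : 5 ≤ Fintype.card V)
    (hp : ∀ u v, T.Adj u v → p u ≠ p v)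
    (Leaf : V → Prop) [DecidablePred Leaf] (s : V → V)
    (hs : ∀ l, Leaf l → ∀ y, T.Adj l y ↔ y = s l)
    (hsl : ∀ l, Leaf l → ¬ Leaf (s l))
    (w : V → V) (hw : ∀ v, ¬ Leaf v → T.Adj v (w v) ∧ ¬ Leaf (w v)) :
    ∃ S : Finset V, S.card + ((Finset.univ.filter Leaf).image s).card ≤ Fintype.card V ∧
      ∀ u v, u ≠ v → closedNbhd T u ∩ (S : Set V) ≠ closedNbhd T v ∩ (S : Set V) := by
  classical
  set Sup : Finset V := (Finset.univ.filter Leaf).image s with hSup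
  have hmS : ∀ x, x ∈ Sup ↔ ∃ l, Leaf l ∧ s l = x := by intro x; simp [hSup]
  have he : ∃ e : V → V, ∀ x ∈ Sup, Leaf (e x) ∧ s (e x) = x := by
    have : ∀ x, ∃ l, x ∈ Sup → Leaf l ∧ s l = x := by
      intro x
      by_cases hx : x ∈ Sup
      · obtain ⟨l, hl⟩ := (hmS x).1 hx
        exact ⟨l, fun _ => hl⟩
      · exact ⟨x, fun h => absurd h hx⟩
    choose e he using this
    exact ⟨e, he⟩
  obtain ⟨e, he⟩ := he
  let D : Finset V := Sup.image e
  have hD : D.card = Sup.card := by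
    apply Finset.card_image_of_injOn
    intro x hx y hy hxy
    rw [← (he x hx).2, ← (he y hy).2]
    exact congrArg s hxy
  have hDm : ∀ v ∈ D, Leaf v ∧ v = e (s v) := by
    intro v hv
    obtain ⟨x, hx, rfl⟩ := Finset.mem_image.1 hv
    have := he x hx
    exact ⟨this.1, by rw [this.2]⟩
  have hnL : ∀ v, ¬ Leaf v → v ∉ D := fun v hv h => hv (hDm v h).1
  refine ⟨Dᶜ, ?_, ?_⟩
  · rw [Finset.card_compl, hD]
    have := Finset.card_le_univ Sup
    omega
  -- a dropped leaf is separated from everything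
  have hdl : ∀ u v, u ≠ v → u ∈ D →
      (∀ z, z ∉ D → ((T.Adj u z ∨ z = u) ↔ (T.Adj v z ∨ z = v))) → False := by
    intro u v huv huD h
    obtain ⟨hu, hue⟩ := hDm u huD
    have hx := hsl u hu
    by_cases hvD : v ∈ D
    · obtain ⟨hv, hve⟩ := hDm v hvD
      rcases (h (s u) (hnL _ hx)).1 (Or.inl ((hs u hu _).2 rfl)) with h1 | h1
      · have h2 := (hs v hv _).1 h1
        apply huv
        rw [hue, hve, h2]
      · exact hx (h1 ▸ hv)
    · rcases (h v hvD).2 (Or.inr rfl) with h1 | h1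
      · have hvx := (hs u hu _).1 h1
        have hwx := hw v (hvx ▸ hx)
        rcases (h _ (hnL _ hwx.2)).2 (Or.inl hwx.1) with h2 | h2
        · exact hwx.1.ne (hvx.trans ((hs u hu _).1 h2).symm)
        · exact hwx.2 (h2 ▸ hu)
      · exact huv h1.symm
  intro u v huv heq
  have h : ∀ z, z ∉ D → ((T.Adj u z ∨ z = u) ↔ (T.Adj v z ∨ z = v)) := by
    intro z hz
    have := Set.ext_iff.1 heq z
    simpa [closedNbhd, hz] using this
  by_cases huD : u ∈ D
  · exact hdl u v huv huD h
  by_cases hvD : v ∈ D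
  · exact hdl v u huv.symm hvD (fun z hz => (h z hz).symm)
  have huv' : T.Adj v u := by
    rcases (h u huD).1 (Or.inr rfl) with h1 | h1
    · exact h1
    · exact absurd h1 huv
  -- all other neighbours are dropped leaves
  have key : ∀ x y z, T.Adj x y → T.Adj x z →
      (∀ z, z ∉ D → ((T.Adj x z ∨ z = x) → (T.Adj y z ∨ z = y))) → z = y ∨ z = e x := by
    intro x y z hxy hxz h
    by_cases hz : z ∈ D
    · obtain ⟨hzl, hze⟩ := hDm z hz
      right
      rw [(hs z hzl x).1 hxz.symm]
      exact hze
    · left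
      rcases h z hz (Or.inl hxz) with h1 | h1
      · exfalso
        have a1 := hp _ _ hxy
        have a2 := hp _ _ hxz
        have a3 := hp _ _ h1
        revert a1 a2 a3
        cases p x <;> cases p y <;> cases p z <;> simp
      · exact h1
  have keyu : ∀ z, T.Adj u z → z = v ∨ z = e u := fun z hz =>
    key u v z huv'.symm hz (fun z hz => (h z hz).1)
  have keyv : ∀ z, T.Adj v z → z = u ∨ z = e v := fun z hz =>
    key v u z huv' hz (fun z hz => (h z hz).2)
  have hend : ∀ x y z, T.Adj x z → z ≠ y → T.Adj x y → (∀ z, T.Adj x z → z = y ∨ z = e x) →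
      (∀ z, z ∉ D → ((T.Adj x z ∨ z = x) → (T.Adj y z ∨ z = y))) → ∀ t, T.Adj z t → t = x := by
    intro x y z hxz hzy hxy hk h t ht
    have hzD : z ∈ D := by
      by_contra hz
      rcases h z hz (Or.inl hxz) with h1 | h1
      · have a1 := hp _ _ hxy
        have a2 := hp _ _ hxz
        have a3 := hp _ _ h1
        revert a1 a2 a3
        cases p x <;> cases p y <;> cases p z <;> simp
      · exact hzy h1
    have hzl := (hDm z hzD).1
    rw [(hs z hzl t).1 ht, ← (hs z hzl x).1 hxz.symm]
  let K : Set V := {z | z = u ∨ z = v ∨ (T.Adj u z ∧ z ≠ v) ∨ (T.Adj v z ∧ z ≠ u)}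
  have hK : ∀ z, z ∈ K := by
    refine conn_closed T hconn K u (Or.inl rfl) ?_
    rintro z (rfl | rfl | ⟨h1, h2⟩ | ⟨h1, h2⟩) t ht
    · by_cases htv : t = v
      · exact Or.inr (Or.inl htv)
      · exact Or.inr (Or.inr (Or.inl ⟨ht, htv⟩))
    · by_cases htv : t = u
      · exact Or.inl htv
      · exact Or.inr (Or.inr (Or.inr ⟨ht, htv⟩))
    · exact Or.inl (hend u v z h1 h2 huv'.symm keyu (fun z hz => (h z hz).1) t ht)
    · exact Or.inr (Or.inl (hend v u z h1 h2 huv' keyv (fun z hz => (h z hz).2) t ht))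
  have hsub : (Finset.univ : Finset V) ⊆ {u, v, e u, e v} := by
    intro z _
    simp only [Finset.mem_insert, Finset.mem_singleton]
    rcases hK z with h1 | h1 | ⟨h1, h2⟩ | ⟨h1, h2⟩
    · exact Or.inl h1
    · exact Or.inr (Or.inl h1)
    · rcases keyu z h1 with h3 | h3
      · exact absurd h3 h2
      · exact Or.inr (Or.inr (Or.inl h3))
    · rcases keyv z h1 with h3 | h3
      · exact absurd h3 h2
      · exact Or.inr (Or.inr (Or.inr h3))
  have h4 : (Finset.univ : Finset V).card ≤ 4 :=
    (Finset.card_le_card hsub).trans Finset.card_le_four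
  rw [Finset.card_univ] at h4
  omega

/-- Stars. -/
lemma rb_star [Fintype V] [DecidableEq V] (T : SimpleGraph V) (c : V → Bool) (x : V)
    (hcard : 5 ≤ Fintype.card V)
    (h1 : ∀ v, v ≠ x → ∀ y, T.Adj v y ↔ y = x) :
    ∃ S : Finset V, 3 * S.card ≤ 2 * Fintype.card V ∧
      ∀ u v, c u ≠ c v → closedNbhd T u ∩ (S : Set V) ≠ closedNbhd T v ∩ (S : Set V) := by
  classical
  let L : Finset V := Finset.univ.erase x
  have hLc : L.card = Fintype.card V - 1 := by
    simp [L, Finset.card_erase_of_mem, Finset.card_univ]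
  have hsplit := Finset.card_filter_add_card_filter_not (s := L) (fun l => c l = true)
  -- minority colour class
  have hM : ∃ M ⊆ L, 2 * M.card ≤ L.card ∧
      ∀ l ∈ L, ∀ l' ∈ L, l ∉ M → l' ∉ M → c l = c l' := by
    by_cases h : (L.filter (fun l => c l = true)).card ≤ (L.filter (fun l => ¬ c l = true)).card
    · refine ⟨_, Finset.filter_subset (fun l => c l = true) _, by omega, ?_⟩
      intro l hl l' hl' a1 a2
      simp only [Finset.mem_filter, not_and, hl, hl', true_implies] at a1 a2
      revert a1 a2
      cases c l <;> cases c l' <;> simp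
    · refine ⟨_, Finset.filter_subset (fun l => ¬ c l = true) _, by omega, ?_⟩
      intro l hl l' hl' a1 a2
      simp only [Finset.mem_filter, not_and, hl, hl', true_implies, not_not] at a1 a2
      rw [a1, a2]
  obtain ⟨M, hML, hM2, hMc⟩ := hM
  obtain ⟨Z, hMZ, hZL, hZc⟩ := Finset.exists_subsuperset_card_eq hML
    (n := max M.card 2) (le_max_left _ _) (by omega)
  refine ⟨insert x Z, ?_, ?_⟩
  · have := Finset.card_insert_le x Z
    omega
  have hxl : ∀ v, v ≠ x → (∀ z ∈ insert x Z, (T.Adj v z ∨ z = v) ↔ (T.Adj x z ∨ z = x)) →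
      False := by
    intro v hv h
    obtain ⟨a, ha, b, hb, hab⟩ := Finset.one_lt_card.1 (show 1 < Z.card by omega)
    have key : ∀ z ∈ Z, z = v := by
      intro z hz
      have hzx : z ≠ x := Finset.ne_of_mem_erase (hZL hz)
      rcases (h z (Finset.mem_insert_of_mem hz)).2
        (Or.inl ((h1 z hzx x).2 rfl).symm) with h2 | h2
      · exact absurd ((h1 v hv z).1 h2) hzx
      · exact h2
    exact hab ((key a ha).trans (key b hb).symm)
  intro u v hc heq
  have h : ∀ z ∈ insert x Z, (T.Adj u z ∨ z = u) ↔ (T.Adj v z ∨ z = v) := by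
    intro z hz
    have h2 := Set.ext_iff.1 heq z
    have h3 : z ∈ ((insert x Z : Finset V) : Set V) := hz
    simp only [Set.mem_inter_iff, h3, and_true] at h2
    exact h2
  have huv : u ≠ v := fun e => hc (by rw [e])
  by_cases hu : u = x
  · subst hu
    exact hxl v huv.symm (fun z hz => (h z hz).symm)
  by_cases hv : v = x
  · subst hv
    exact hxl u huv h
  have hmem : ∀ u v, u ≠ v → u ≠ x → v ≠ x →
      (∀ z ∈ insert x Z, (T.Adj u z ∨ z = u) ↔ (T.Adj v z ∨ z = v)) → u ∉ M := by
    intro u v huv hu hv h hm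
    rcases (h u (Finset.mem_insert_of_mem (hMZ hm))).1 (Or.inr rfl) with h2 | h2
    · exact hu ((h1 v hv u).1 h2)
    · exact huv h2
  exact hc (hMc u (by simp [L, hu]) v (by simp [L, hv]) (hmem u v huv hu hv h)
    (hmem v u huv.symm hv hu (fun z hz => (h z hz).symm)))

lemma rb_main [Fintype V] (T : SimpleGraph V) (hT : T.IsTree)
    (hn : 5 ≤ Fintype.card V) (c : V → Bool) :
    ∃ S : Finset V, 3 * S.card ≤ 2 * Fintype.card V ∧
      ∀ u v, c u ≠ c v → closedNbhd T u ∩ (S : Set V) ≠ closedNbhd T v ∩ (S : Set V) := by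
  classical
  have hconn := hT.connected
  have hp : ∃ p : V → Bool, ∀ u v, T.Adj u v → p u ≠ p v := by
    let f := hT.coloringTwo
    refine ⟨fun v => decide (f v = 0), ?_⟩
    intro u v huv h
    have := f.valid huv
    simp only [decide_eq_decide] at h
    omega
  obtain ⟨p, hp⟩ := hp
  have hC4 : ∀ u v y z, u ≠ v → T.Adj u y → T.Adj u z → T.Adj v y → T.Adj v z → y = z := by
    intro u v y z huv h1 h2 h3 h4
    let q1 : T.Walk u v := .cons h1 (.cons h3.symm .nil)
    let q2 : T.Walk u v := .cons h2 (.cons h4.symm .nil)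
    have e1 : q1.IsPath := by simp [q1, h1.ne, huv, h3.ne']
    have e2 : q2.IsPath := by simp [q2, h2.ne, huv, h4.ne']
    have := hT.isAcyclic.path_unique ⟨q1, e1⟩ ⟨q2, e2⟩
    have h5 : q1.snd = q2.snd := by rw [Subtype.mk.inj this]
    simpa [q1, q2] using h5
  let Leaf : V → Prop := fun v => ∃ x, ∀ y, T.Adj v y ↔ y = x
  have hs : ∃ s : V → V, ∀ l, Leaf l → ∀ y, T.Adj l y ↔ y = s l := by
    have : ∀ l, ∃ x, Leaf l → ∀ y, T.Adj l y ↔ y = x := by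
      intro l
      by_cases h : Leaf l
      · obtain ⟨x, hx⟩ := h
        exact ⟨x, fun _ => hx⟩
      · exact ⟨l, fun h' => absurd h' h⟩
    choose s hs using this
    exact ⟨s, hs⟩
  obtain ⟨s, hs⟩ := hs
  have hnbr : ∀ v, ∃ y, T.Adj v y := by
    intro v
    by_contra! hno
    have hall := conn_closed T hconn {v} v rfl
      (fun u hu t ht => absurd (show T.Adj v t from hu ▸ ht) (hno t))
    have : Fintype.card V ≤ 1 := Fintype.card_le_one_iff.2
      (fun a b => (show a = v from hall a).trans (show b = v from hall b).symm)
    omega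
  have hnl : ∀ v, ¬ Leaf v → ∀ x, ∃ y, T.Adj v y ∧ y ≠ x := by
    intro v hv x
    by_contra! hno
    obtain ⟨y, hy⟩ := hnbr v
    have hyx := hno y hy
    subst hyx
    exact hv ⟨y, fun z => ⟨hno z, fun e => e ▸ hy⟩⟩
  have hsl : ∀ l, Leaf l → ¬ Leaf (s l) := by
    intro l hl hx
    have hadj := (hs l hl _).2 rfl
    have hall := conn_closed T hconn {z | z = l ∨ z = s l} l (Or.inl rfl) (by
      rintro u (rfl | rfl) t ht
      · exact Or.inr ((hs _ hl t).1 ht)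
      · left
        exact ((hs _ hx t).1 ht).trans ((hs _ hx l).1 hadj.symm).symm)
    have hsub : (Finset.univ : Finset V) ⊆ {l, s l} := by
      intro z _
      simpa using hall z
    have h4 := (Finset.card_le_card hsub).trans Finset.card_le_two
    rw [Finset.card_univ] at h4
    omega
  by_cases hstar : ∃ x, ¬ Leaf x ∧ ∀ y, T.Adj x y → Leaf y
  · obtain ⟨x, hx, hxl⟩ := hstar
    have hall := conn_closed T hconn {z | z = x ∨ T.Adj x z} x (Or.inl rfl) (by
      rintro u (rfl | hu) t ht
      · exact Or.inr ht
      · left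
        have hl := hxl u hu
        exact ((hs u hl t).1 ht).trans ((hs u hl x).1 hu.symm).symm)
    apply rb_star T c x hn
    intro v hv y
    have hxv : T.Adj x v := (hall v).resolve_left hv
    rw [hs v (hxl v hxv), (hs v (hxl v hxv) x).1 hxv.symm]
  · push Not at hstar
    have hw : ∃ w : V → V, ∀ v, ¬ Leaf v → T.Adj v (w v) ∧ ¬ Leaf (w v) := by
      choose! w hw using hstar
      exact ⟨w, hw⟩
    obtain ⟨w, hw⟩ := hw
    obtain ⟨S, hS, hS'⟩ := rb_half T c p hp hC4 Leaf s hs hnl hsl w hw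
    obtain ⟨S₂, hS₂, hS₂'⟩ := rb_drop T p hconn hn hp Leaf s hs hsl w hw
    by_cases h : 3 * S.card ≤ 2 * Fintype.card V
    · exact ⟨S, h, hS'⟩
    · refine ⟨S₂, by omega, ?_⟩
      intro u v huv
      exact hS₂' u v (fun e => huv (by rw [e]))

end RBProof

theorem stmt16 {V : Type*} [Fintype V] (T : SimpleGraph V) (hT : T.IsTree)
    (hn : 5 ≤ Fintype.card V) :
    (maxsepRB T : ℝ) ≤ 2 * (Fintype.card V : ℝ) / 3 := by
  have h : 3 * maxsepRB T ≤ 2 * Fintype.card V := by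
    have h1 : maxsepRB T ≤ 2 * Fintype.card V / 3 := by
      apply csSup_le (Set.range_nonempty _)
      rintro _ ⟨c, rfl⟩
      obtain ⟨S, hS, hS'⟩ := rb_main T hT hn c
      have h2 : sepRB T c ≤ S.card := Nat.sInf_le ⟨S, rfl, fun r b hr hb =>
        hS' r b (by rw [hr, hb]; decide)⟩
      show sepRB T c ≤ _
      omega
    omega
  have h' : (3 : ℝ) * (maxsepRB T : ℝ) ≤ 2 * (Fintype.card V : ℝ) := by exact_mod_cast h
  linarith
end
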